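/- arXiv:math/0703453 — 2 statements merged into one kernel-verified Lean document; each statement's English description precedes it below -/
import Mathlib

section
/- For every x ∈ V there is at most one direction A ∈ DIR such that the function t ↦ INF(x,A,t) on the positive integers t with t ≡ x₁ (mod 2) is strictly bimodal. -/
open Finset

/-- Vertices: we work on `ℤ × ℤ`; the grid `V` consists of points with
`x₁ ≡ x₂ (mod 2)`. -/
abbrev Vtx : Type := ℤ × ℤ

/-- The four diagonal directions. -/
def DIRset : Finset Vtx := {(1,1), (1,-1), (-1,-1), (-1,1)}

/-- Membership in `V`: both coordinates have the same parity. -/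
def inV (x : Vtx) : Prop := x.1 % 2 = x.2 % 2

/-- `H x t`: probability that a random-walk chip starting at `x` is at the
origin after `t` steps. -/
noncomputable def H (x : Vtx) (t : ℕ) : ℝ :=
  if x.1 % 2 = (t : ℤ) % 2 ∧ x.2 % 2 = (t : ℤ) % 2 ∧ |x.1| ≤ (t : ℤ) ∧ |x.2| ≤ (t : ℤ) then
    (4 : ℝ) ^ (-(t : ℤ)) * (Nat.choose t (((t : ℤ) + x.1) / 2).toNat)
      * (Nat.choose t (((t : ℤ) + x.2) / 2).toNat)
  else 0

/-- `INF x A t := H (x+A) (t-1) - H x t`, for `t ≥ 1`. -/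
noncomputable def INF (x A : Vtx) (t : ℕ) : ℝ := H (x + A) (t - 1) - H x t

/-- A function is monotone-or-antitone on a set. -/
def MonoOrAntiOn (g : ℕ → ℝ) (S : Set ℕ) : Prop := MonotoneOn g S ∨ AntitoneOn g S

/-- Unimodal on `X`: monotone up to some `t₁ ∈ X` and monotone from `t₁` on. -/
def UnimodalOn (g : ℕ → ℝ) (X : Set ℕ) : Prop :=
  ∃ t₁ ∈ X, MonoOrAntiOn g (X ∩ Set.Iic t₁) ∧ MonoOrAntiOn g (X ∩ Set.Ici t₁)

/-- Bimodal on `X`: monotone on `{≤ t₁}`, `[t₁,t₂]` and `{≥ t₂}` for some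
`t₁ ≤ t₂` in `X`. -/
def BimodalOn (g : ℕ → ℝ) (X : Set ℕ) : Prop :=
  ∃ t₁ ∈ X, ∃ t₂ ∈ X, t₁ ≤ t₂ ∧ MonoOrAntiOn g (X ∩ Set.Iic t₁) ∧
    MonoOrAntiOn g (X ∩ Set.Icc t₁ t₂) ∧ MonoOrAntiOn g (X ∩ Set.Ici t₂)

/-- Strictly bimodal: bimodal but not unimodal. -/
def StrictlyBimodalOn (g : ℕ → ℝ) (X : Set ℕ) : Prop :=
  BimodalOn g X ∧ ¬ UnimodalOn g X

/-- The domain of times considered at a vertex `x`: positive integers `t`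
with `t ≡ x₁ (mod 2)`. -/
def Xdom (x : Vtx) : Set ℕ := {t : ℕ | 1 ≤ t ∧ (t : ℤ) % 2 = x.1 % 2}

/-- The polynomial deciding the sign of the increment. -/
def DD (A B c d t : ℤ) : ℤ :=
  t^2*(t+1)^2*(c*(t+2)+d) - (c*t+d)*((t+2)^2-A)*((t+2)^2-B)

theorem quart_sign (c4 c3 c2 c1 c0 s s' : ℤ) (h4 : c4 ≤ 0) (hs : 0 ≤ s) (hss : s ≤ s')
    (k3 : 0 ≤ c3 → 0 ≤ c2) (k2 : 0 ≤ c2 → 0 ≤ c1) (k1 : 0 ≤ c1 → 0 ≤ c0)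
    (h : c4*s^4 + c3*s^3 + c2*s^2 + c1*s + c0 < 0) :
    c4*s'^4 + c3*s'^3 + c2*s'^2 + c1*s' + c0 ≤ 0 := by
  have hs' : 0 ≤ s' := hs.trans hss
  have p2 : s^2 ≤ s'^2 := by gcongr
  have p3 : s^3 ≤ s'^3 := by gcongr
  have p4 : s^4 ≤ s'^4 := by gcongr
  have q4 : c4*s'^4 ≤ c4*s^4 := mul_le_mul_of_nonpos_left p4 h4
  rcases lt_or_ge c1 0 with h1 | h1
  · have h2 : c2 < 0 := by by_contra hh; exact absurd (k2 (not_lt.mp hh)) (not_le.mpr h1)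
    have h3 : c3 < 0 := by by_contra hh; exact absurd (k3 (not_lt.mp hh)) (not_le.mpr h2)
    have q3 : c3*s'^3 ≤ c3*s^3 := mul_le_mul_of_nonpos_left p3 h3.le
    have q2 : c2*s'^2 ≤ c2*s^2 := mul_le_mul_of_nonpos_left p2 h2.le
    have q1 : c1*s' ≤ c1*s := mul_le_mul_of_nonpos_left hss h1.le
    linarith
  have h0 := k1 h1
  have hpos : 0 < s := by
    rcases hs.eq_or_lt with rfl | h'
    · simp at h; omega
    · exact h'
  have hpos' : 0 < s' := by linarith
  rcases lt_or_ge c2 0 with h2 | h2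
  · have h3 : c3 < 0 := by by_contra hh; exact absurd (k3 (not_lt.mp hh)) (not_le.mpr h2)
    have e : s * (c4*s'^4 + c3*s'^3 + c2*s'^2 + c1*s' + c0)
        = s' * (c4*s^4 + c3*s^3 + c2*s^2 + c1*s + c0)
        + c4*(s*s'*(s'^3-s^3)) + c3*(s*s'*(s'^2-s^2)) + c2*(s*s'*(s'-s)) - c0*(s'-s) := by ring
    have r4 : c4*(s*s'*(s'^3-s^3)) ≤ 0 := mul_nonpos_of_nonpos_of_nonneg h4
      (mul_nonneg (mul_nonneg hs hs') (by linarith))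
    have r3 : c3*(s*s'*(s'^2-s^2)) ≤ 0 := mul_nonpos_of_nonpos_of_nonneg h3.le
      (mul_nonneg (mul_nonneg hs hs') (by linarith))
    have r2 : c2*(s*s'*(s'-s)) ≤ 0 := mul_nonpos_of_nonpos_of_nonneg h2.le
      (mul_nonneg (mul_nonneg hs hs') (by linarith))
    have r0 : 0 ≤ c0*(s'-s) := mul_nonneg h0 (by linarith)
    have r := mul_neg_of_pos_of_neg hpos' h
    by_contra hc
    have := mul_pos hpos (not_le.mp hc)
    linarith
  rcases lt_or_ge c3 0 with h3 | h3
  · have e : s^2 * (c4*s'^4 + c3*s'^3 + c2*s'^2 + c1*s' + c0)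
        = s'^2 * (c4*s^4 + c3*s^3 + c2*s^2 + c1*s + c0)
        + c4*(s^2*s'^2*(s'^2-s^2)) + c3*(s^2*s'^2*(s'-s)) - c1*(s*s'*(s'-s))
        - c0*(s'^2-s^2) := by ring
    have r4 : c4*(s^2*s'^2*(s'^2-s^2)) ≤ 0 := mul_nonpos_of_nonpos_of_nonneg h4
      (mul_nonneg (by positivity) (by linarith))
    have r3 : c3*(s^2*s'^2*(s'-s)) ≤ 0 := mul_nonpos_of_nonpos_of_nonneg h3.le
      (mul_nonneg (by positivity) (by linarith))
    have r1 : 0 ≤ c1*(s*s'*(s'-s)) := mul_nonneg h1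
      (mul_nonneg (by positivity) (by linarith))
    have r0 : 0 ≤ c0*(s'^2-s^2) := mul_nonneg h0 (by linarith)
    have r := mul_neg_of_pos_of_neg (pow_pos hpos' 2) h
    by_contra hc
    have := mul_pos (pow_pos hpos 2) (not_le.mp hc)
    linarith
  · have e : s^3 * (c4*s'^4 + c3*s'^3 + c2*s'^2 + c1*s' + c0)
        = s'^3 * (c4*s^4 + c3*s^3 + c2*s^2 + c1*s + c0)
        + c4*(s^3*s'^3*(s'-s)) - c2*(s^2*s'^2*(s'-s)) - c1*(s*s'*(s'^2-s^2))
        - c0*(s'^3-s^3) := by ring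
    have r4 : c4*(s^3*s'^3*(s'-s)) ≤ 0 := mul_nonpos_of_nonpos_of_nonneg h4
      (mul_nonneg (by positivity) (by linarith))
    have r2 : 0 ≤ c2*(s^2*s'^2*(s'-s)) := mul_nonneg h2
      (mul_nonneg (by positivity) (by linarith))
    have r1 : 0 ≤ c1*(s*s'*(s'^2-s^2)) := mul_nonneg h1
      (mul_nonneg (by positivity) (by linarith))
    have r0 : 0 ≤ c0*(s'^3-s^3) := mul_nonneg h0 (by linarith)
    have r := mul_neg_of_pos_of_neg (pow_pos hpos' 3) h
    by_contra hc
    have := mul_pos (pow_pos hpos 3) (not_le.mp hc)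
    linarith

theorem dsign_one (a b t t' : ℤ) (hb : 0 ≤ b) (hab : b ≤ a) (ht : a ≤ t) (htt : t ≤ t')
    (h : DD (a^2) (b^2) (a+b) (-(a*b)) t < 0) : DD (a^2) (b^2) (a+b) (-(a*b)) t' ≤ 0 := by
  obtain ⟨s, rfl⟩ : ∃ s, t = a + s := ⟨t - a, by ring⟩
  obtain ⟨s', rfl⟩ : ∃ s', t' = a + s' := ⟨t' - a, by ring⟩
  have key := quart_sign
    (-4*a - 4*b)
    (1*a^3 + 1*a^2*b - 16*a^2 + 1*a*b^2 - 10*a*b - 19*a + 1*b^3 - 19*b)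
    (3*a^4 + 2*a^3*b - 20*a^3 + 3*a^2*b^2 - 2*a^2*b - 57*a^2 + 2*a*b^3 + 4*a*b^2 - 34*a*b - 30*a + 4*b^3 - 30*b)
    (3*a^5 + 1*a^4*b - 8*a^4 + 2*a^3*b^2 + 6*a^3*b - 53*a^3 + 8*a^2*b^2 - 7*a^2*b - 60*a^2 + 4*a*b^3 + 4*a*b^2 - 28*a*b - 16*a + 4*b^3 - 16*b)
    (1*a^6 + 2*a^4*b - 15*a^4 + 4*a^3*b^2 + 4*a^3*b - 30*a^3 + 4*a^2*b^2 + 2*a^2*b - 16*a^2)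
    s s' (by linarith) (by linarith) (by linarith)
  have conds : (0 ≤ 1*a^3 + 1*a^2*b - 16*a^2 + 1*a*b^2 - 10*a*b - 19*a + 1*b^3 - 19*b → 0 ≤ 3*a^4 + 2*a^3*b - 20*a^3 + 3*a^2*b^2 - 2*a^2*b - 57*a^2 + 2*a*b^3 + 4*a*b^2 - 34*a*b - 30*a + 4*b^3 - 30*b) ∧ (0 ≤ 3*a^4 + 2*a^3*b - 20*a^3 + 3*a^2*b^2 - 2*a^2*b - 57*a^2 + 2*a*b^3 + 4*a*b^2 - 34*a*b - 30*a + 4*b^3 - 30*b → 0 ≤ 3*a^5 + 1*a^4*b - 8*a^4 + 2*a^3*b^2 + 6*a^3*b - 53*a^3 + 8*a^2*b^2 - 7*a^2*b - 60*a^2 + 4*a*b^3 + 4*a*b^2 - 28*a*b - 16*a + 4*b^3 - 16*b) ∧ (0 ≤ 3*a^5 + 1*a^4*b - 8*a^4 + 2*a^3*b^2 + 6*a^3*b - 53*a^3 + 8*a^2*b^2 - 7*a^2*b - 60*a^2 + 4*a*b^3 + 4*a*b^2 - 28*a*b - 16*a + 4*b^3 - 16*b → 0 ≤ 1*a^6 +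 2*a^4*b - 15*a^4 + 4*a^3*b^2 + 4*a^3*b - 30*a^3 + 4*a^2*b^2 + 2*a^2*b - 16*a^2) := by
    rcases le_or_gt 11 a with h11 | h11
    · obtain ⟨e, rfl⟩ : ∃ e, a = b + e := ⟨a - b, by ring⟩
      have he : 0 ≤ e := by linarith
      have M : ∀ i j : ℕ, 0 ≤ e^i*b^j := fun i j => by positivity
      have N : ∀ i j : ℕ, 0 ≤ e^i*b^j*(b+e-11) := fun i j => mul_nonneg (M i j) (by linarith)
      clear key h htt ht
      refine ⟨fun _ => ?_, fun _ => ?_, fun _ => ?_⟩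
      · linarith [M 0 4, M 1 3, M 2 2, M 3 1, M 4 0, N 0 0, N 0 1, N 1 0, N 0 2, N 1 1, N 2 0, N 0 3, N 1 2, N 2 1, N 3 0]
      · linarith [M 0 5, M 1 4, M 2 3, M 3 2, M 4 1, M 5 0, N 0 0, N 0 1, N 1 0, N 0 2, N 1 1, N 2 0, N 0 3, N 1 2, N 2 1, N 3 0, N 0 4, N 1 3, N 2 2, N 3 1, N 4 0]
      · linarith [M 0 6, M 1 5, M 2 4, M 3 3, M 4 2, M 5 1, M 6 0, N 0 0, N 0 1, N 1 0, N 0 2, N 1 1, N 2 0, N 0 3, N 1 2, N 2 1, N 3 0, N 0 4, N 1 3, N 2 2, N 3 1, N 4 0, N 0 5, N 1 4, N 2 3, N 3 2, N 4 1, N 5 0]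
    · have ha : 0 ≤ a := hb.trans hab
      clear key h htt ht
      interval_cases a <;> interval_cases b <;> norm_num
  obtain ⟨k3, k2, k1⟩ := conds
  refine le_trans (le_of_eq ?_) (key k3 k2 k1 (lt_of_eq_of_lt ?_ h))
  · unfold DD; ring
  · unfold DD; ring

theorem dsign_two (a b t t' : ℤ) (hb : 0 ≤ b) (hab : b ≤ a) (ht : a ≤ t) (htt : t ≤ t')
    (h : DD (a^2) (b^2) (a+b) (a*b) t < 0) : DD (a^2) (b^2) (a+b) (a*b) t' ≤ 0 := by
  obtain ⟨s, rfl⟩ : ∃ s, t = a + s := ⟨t - a, by ring⟩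
  obtain ⟨s', rfl⟩ : ∃ s', t' = a + s' := ⟨t' - a, by ring⟩
  have key := quart_sign
    (-4*a - 4*b)
    (1*a^3 + 1*a^2*b - 16*a^2 + 1*a*b^2 - 22*a*b - 19*a + 1*b^3 - 19*b)
    (3*a^4 + 4*a^3*b - 20*a^3 + 3*a^2*b^2 - 38*a^2*b - 57*a^2 + 4*a*b^3 + 4*a*b^2 - 80*a*b - 30*a + 4*b^3 - 30*b)
    (3*a^5 + 5*a^4*b - 8*a^4 + 2*a^3*b^2 - 22*a^3*b - 53*a^3 + 4*a^2*b^3 + 8*a^2*b^2 - 99*a^2*b - 60*a^2 + 12*a*b^3 + 4*a*b^2 - 92*a*b - 16*a + 4*b^3 - 16*b)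
    (1*a^6 + 2*a^5*b - 2*a^4*b - 15*a^4 + 4*a^3*b^2 - 34*a^3*b - 30*a^3 + 8*a^2*b^3 + 4*a^2*b^2 - 62*a^2*b - 16*a^2 + 8*a*b^3 - 32*a*b)
    s s' (by linarith) (by linarith) (by linarith)
  have conds : (0 ≤ 1*a^3 + 1*a^2*b - 16*a^2 + 1*a*b^2 - 22*a*b - 19*a + 1*b^3 - 19*b → 0 ≤ 3*a^4 + 4*a^3*b - 20*a^3 + 3*a^2*b^2 - 38*a^2*b - 57*a^2 + 4*a*b^3 + 4*a*b^2 - 80*a*b - 30*a + 4*b^3 - 30*b) ∧ (0 ≤ 3*a^4 + 4*a^3*b - 20*a^3 + 3*a^2*b^2 - 38*a^2*b - 57*a^2 + 4*a*b^3 + 4*a*b^2 - 80*a*b - 30*a + 4*b^3 - 30*b → 0 ≤ 3*a^5 + 5*a^4*b - 8*a^4 + 2*a^3*b^2 - 22*a^3*b - 53*a^3 + 4*a^2*b^3 + 8*a^2*b^2 - 99*a^2*b - 60*a^2 + 12*a*b^3 + 4*a*b^2 - 92*a*b - 16*a + 4*b^3 - 16*b) ∧ (0 ≤ 3*a^5 +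 5*a^4*b - 8*a^4 + 2*a^3*b^2 - 22*a^3*b - 53*a^3 + 4*a^2*b^3 + 8*a^2*b^2 - 99*a^2*b - 60*a^2 + 12*a*b^3 + 4*a*b^2 - 92*a*b - 16*a + 4*b^3 - 16*b → 0 ≤ 1*a^6 + 2*a^5*b - 2*a^4*b - 15*a^4 + 4*a^3*b^2 - 34*a^3*b - 30*a^3 + 8*a^2*b^3 + 4*a^2*b^2 - 62*a^2*b - 16*a^2 + 8*a*b^3 - 32*a*b) := by
    rcases le_or_gt 11 a with h11 | h11
    · obtain ⟨e, rfl⟩ : ∃ e, a = b + e := ⟨a - b, by ring⟩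
      have he : 0 ≤ e := by linarith
      have M : ∀ i j : ℕ, 0 ≤ e^i*b^j := fun i j => by positivity
      have N : ∀ i j : ℕ, 0 ≤ e^i*b^j*(b+e-11) := fun i j => mul_nonneg (M i j) (by linarith)
      clear key h htt ht
      refine ⟨fun _ => ?_, fun _ => ?_, fun _ => ?_⟩
      · linarith [M 0 4, M 1 3, M 2 2, M 3 1, M 4 0, N 0 0, N 0 1, N 1 0, N 0 2, N 1 1, N 2 0, N 0 3, N 1 2, N 2 1, N 3 0]
      · linarith [M 0 5, M 1 4, M 2 3, M 3 2, M 4 1, M 5 0, N 0 0, N 0 1, N 1 0, N 0 2, N 1 1, N 2 0, N 0 3, N 1 2, N 2 1, N 3 0, N 0 4, N 1 3, N 2 2, N 3 1, N 4 0]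
      · linarith [M 0 6, M 1 5, M 2 4, M 3 3, M 4 2, M 5 1, M 6 0, N 0 0, N 0 1, N 1 0, N 0 2, N 1 1, N 2 0, N 0 3, N 1 2, N 2 1, N 3 0, N 0 4, N 1 3, N 2 2, N 3 1, N 4 0, N 0 5, N 1 4, N 2 3, N 3 2, N 4 1, N 5 0]
    · have ha : 0 ≤ a := hb.trans hab
      clear key h htt ht
      interval_cases a <;> interval_cases b <;> norm_num
  obtain ⟨k3, k2, k1⟩ := conds
  refine le_trans (le_of_eq ?_) (key k3 k2 k1 (lt_of_eq_of_lt ?_ h))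
  · unfold DD; ring
  · unfold DD; ring

theorem dsign_three (a b t t' : ℤ) (hb : 0 ≤ b) (hab : b ≤ a) (ht : a ≤ t) (htt : t ≤ t')
    (h : DD (a^2) (b^2) (a-b) (a*b) t < 0) : DD (a^2) (b^2) (a-b) (a*b) t' ≤ 0 := by
  obtain ⟨s, rfl⟩ : ∃ s, t = a + s := ⟨t - a, by ring⟩
  obtain ⟨s', rfl⟩ : ∃ s', t' = a + s' := ⟨t' - a, by ring⟩
  have key := quart_sign
    (-4*a + 4*b)
    (1*a^3 - 1*a^2*b - 16*a^2 + 1*a*b^2 + 10*a*b - 19*a - 1*b^3 + 19*b)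
    (3*a^4 - 2*a^3*b - 20*a^3 + 3*a^2*b^2 + 2*a^2*b - 57*a^2 - 2*a*b^3 + 4*a*b^2 + 34*a*b - 30*a - 4*b^3 + 30*b)
    (3*a^5 - 1*a^4*b - 8*a^4 + 2*a^3*b^2 - 6*a^3*b - 53*a^3 + 8*a^2*b^2 + 7*a^2*b - 60*a^2 - 4*a*b^3 + 4*a*b^2 + 28*a*b - 16*a - 4*b^3 + 16*b)
    (1*a^6 - 2*a^4*b - 15*a^4 + 4*a^3*b^2 - 4*a^3*b - 30*a^3 + 4*a^2*b^2 - 2*a^2*b - 16*a^2)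
    s s' (by linarith) (by linarith) (by linarith)
  have conds : (0 ≤ 1*a^3 - 1*a^2*b - 16*a^2 + 1*a*b^2 + 10*a*b - 19*a - 1*b^3 + 19*b → 0 ≤ 3*a^4 - 2*a^3*b - 20*a^3 + 3*a^2*b^2 + 2*a^2*b - 57*a^2 - 2*a*b^3 + 4*a*b^2 + 34*a*b - 30*a - 4*b^3 + 30*b) ∧ (0 ≤ 3*a^4 - 2*a^3*b - 20*a^3 + 3*a^2*b^2 + 2*a^2*b - 57*a^2 - 2*a*b^3 + 4*a*b^2 + 34*a*b - 30*a - 4*b^3 + 30*b → 0 ≤ 3*a^5 - 1*a^4*b - 8*a^4 + 2*a^3*b^2 - 6*a^3*b - 53*a^3 + 8*a^2*b^2 + 7*a^2*b - 60*a^2 - 4*a*b^3 + 4*a*b^2 + 28*a*b - 16*a - 4*b^3 + 16*b) ∧ (0 ≤ 3*a^5 - 1*a^4*b - 8*a^4 + 2*a^3*b^2 - 6*a^3*b - 53*a^3 + 8*a^2*b^2 + 7*a^2*b - 60*a^2 - 4*a*b^3 + 4*a*b^2 + 28*a*b - 16*a - 4*b^3 + 16*b → 0 ≤ 1*a^6 -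 2*a^4*b - 15*a^4 + 4*a^3*b^2 - 4*a^3*b - 30*a^3 + 4*a^2*b^2 - 2*a^2*b - 16*a^2) := by
    rcases le_or_gt 11 a with h11 | h11
    · obtain ⟨e, rfl⟩ : ∃ e, a = b + e := ⟨a - b, by ring⟩
      have he : 0 ≤ e := by linarith
      have M : ∀ i j : ℕ, 0 ≤ e^i*b^j := fun i j => by positivity
      have N : ∀ i j : ℕ, 0 ≤ e^i*b^j*(b+e-11) := fun i j => mul_nonneg (M i j) (by linarith)
      clear key h htt ht
      refine ⟨fun _ => ?_, fun _ => ?_, fun _ => ?_⟩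
      · linarith [M 0 4, M 1 3, M 2 2, M 3 1, M 4 0, N 0 0, N 0 1, N 1 0, N 0 2, N 1 1, N 2 0, N 0 3, N 1 2, N 2 1, N 3 0]
      · linarith [M 0 5, M 1 4, M 2 3, M 3 2, M 4 1, M 5 0, N 0 0, N 0 1, N 1 0, N 0 2, N 1 1, N 2 0, N 0 3, N 1 2, N 2 1, N 3 0, N 0 4, N 1 3, N 2 2, N 3 1, N 4 0]
      · linarith [M 0 6, M 1 5, M 2 4, M 3 3, M 4 2, M 5 1, M 6 0, N 0 0, N 0 1, N 1 0, N 0 2, N 1 1, N 2 0, N 0 3, N 1 2, N 2 1, N 3 0, N 0 4, N 1 3, N 2 2, N 3 1, N 4 0, N 0 5, N 1 4, N 2 3, N 3 2, N 4 1, N 5 0]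
    · have ha : 0 ≤ a := hb.trans hab
      clear key h htt ht
      interval_cases a <;> interval_cases b <;> norm_num
  obtain ⟨k3, k2, k1⟩ := conds
  refine le_trans (le_of_eq ?_) (key k3 k2 k1 (lt_of_eq_of_lt ?_ h))
  · unfold DD; ring
  · unfold DD; ring

noncomputable def FF (a : ℤ) (t : ℕ) : ℝ :=
  if a % 2 = (t : ℤ) % 2 ∧ |a| ≤ (t : ℤ) then
    ((2 : ℝ) ^ t)⁻¹ * (Nat.choose t (((t : ℤ) + a) / 2).toNat) else 0

theorem H_eq_FF (x : Vtx) (t : ℕ) : H x t = FF x.1 t * FF x.2 t := by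
  unfold H FF
  by_cases h1 : x.1 % 2 = (t : ℤ) % 2 ∧ |x.1| ≤ (t : ℤ)
  · by_cases h2 : x.2 % 2 = (t : ℤ) % 2 ∧ |x.2| ≤ (t : ℤ)
    · rw [if_pos ⟨h1.1, h2.1, h1.2, h2.2⟩, if_pos h1, if_pos h2]
      have : (4:ℝ) ^ (-(t:ℤ)) = ((2 : ℝ) ^ t)⁻¹ * ((2 : ℝ) ^ t)⁻¹ := by
        rw [zpow_neg, zpow_natCast, ← mul_inv, ← mul_pow]; norm_num
      rw [this]; ring
    · rw [if_neg (fun h => h2 ⟨h.2.1, h.2.2.2⟩), if_neg h2, mul_zero]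
  · rw [if_neg (fun h => h1 ⟨h.1, h.2.2.1⟩), if_neg h1, zero_mul]

theorem FF_zero {a : ℤ} {t : ℕ} (h : (t : ℤ) < |a|) : FF a t = 0 :=
  if_neg (fun h' => absurd h'.2 (not_le.mpr h))

theorem FF_nonneg (a : ℤ) (t : ℕ) : 0 ≤ FF a t := by
  unfold FF; split_ifs <;> positivity

theorem FF_mn (m n : ℕ) : FF ((m : ℤ) - n) (m + n) = ((2 : ℝ) ^ (m+n))⁻¹ * (Nat.choose (m+n) m) := by
  unfold FF
  rw [if_pos]
  · congr 3
    push_cast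
    omega
  · push_cast
    refine ⟨by omega, abs_le.mpr ⟨by omega, by omega⟩⟩

theorem exists_mn {a : ℤ} {t : ℕ} (h : a % 2 = (t : ℤ) % 2) (h' : |a| ≤ (t : ℤ)) :
    ∃ m n : ℕ, a = (m : ℤ) - n ∧ t = m + n := by
  rw [abs_le] at h'
  refine ⟨((t + a)/2).toNat, ((t - a)/2).toNat, by omega, by omega⟩

theorem FF_step {a : ℤ} {t : ℕ} (h : a % 2 = (t : ℤ) % 2) :
    FF a (t+2) * (((t:ℝ)+2)^2 - (a:ℝ)^2) = FF a t * (((t:ℝ)+1)*((t:ℝ)+2)) := by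
  rcases le_or_gt |a| (t:ℤ) with h' | h'
  · obtain ⟨m, n, rfl, rfl⟩ := exists_mn h h'
    have e1 : ((m:ℤ) - n) = ((m+1 : ℕ):ℤ) - ((n+1 : ℕ) : ℤ) := by push_cast; ring
    have e2 : m + n + 2 = (m+1) + (n+1) := by ring
    rw [FF_mn, e2]
    conv_lhs => rw [e1, FF_mn]
    have c1 : ((m+1+(n+1)).choose (m+1) : ℝ) * ((m:ℝ)+1) * (n+1)
        = ((m+n).choose m : ℝ) * ((m:ℝ)+n+1)*(m+n+2) := by
      have a1 := Nat.add_one_mul_choose_eq (m+n+1) m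
      have a2 := Nat.add_one_mul_choose_eq (m+n) n
      have b1 : (m+n+1).choose m = (m+n+1).choose (n+1) := by
        rw [← Nat.choose_symm_of_eq_add]; ring
      have b2 : (m+n).choose n = (m+n).choose m := by
        rw [← Nat.choose_symm_of_eq_add]; ring
      have e3 : m+1+(n+1) = m+n+1+1 := by ring
      rw [b1] at a1
      rw [b2] at a2
      rw [e3]
      have a1' : ((m:ℝ)+n+1+1) * ((m+n+1).choose (n+1)) = ((m+n+1+1).choose (m+1)) * (m+1) := by
        exact_mod_cast a1
      have a2' : ((m:ℝ)+n+1) * ((m+n).choose m) = ((m+n+1).choose (n+1)) * (n+1) := by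
        exact_mod_cast a2
      linear_combination (-(n+1:ℝ)) * a1' - (m+n+2:ℝ) * a2'
    have p : ((2:ℝ)^(m+1+(n+1)))⁻¹ = (2^(m+n))⁻¹ / 4 := by
      rw [show m+1+(n+1) = m+n+2 by ring, pow_add]; field_simp; norm_num
    rw [p]
    push_cast
    linear_combination ((2:ℝ)^(m+n))⁻¹ * c1
  · rw [FF_zero h']
    rcases le_or_gt |a| ((t+2 : ℕ):ℤ) with h2 | h2
    · have : |a| = (t:ℤ)+2 := by
        push_cast at h2
        rcases abs_cases a with ⟨e, _⟩ | ⟨e, _⟩ <;> rw [e] at h' h2 ⊢ <;> omega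
      have : (a:ℝ)^2 = ((t:ℝ)+2)^2 := by
        have := congrArg (fun z : ℤ => (z:ℝ)^2) this
        simpa using this
      rw [this]; ring
    · rw [FF_zero h2]; ring

theorem FF_shift {a e : ℤ} {t : ℕ} (ht : 1 ≤ t) (h : a % 2 = (t : ℤ) % 2) (he : e = 1 ∨ e = -1) :
    FF (a+e) (t-1) * t = FF a t * ((t:ℝ) - e * a) := by
  rcases le_or_gt |a| (t:ℤ) with h' | h'
  · obtain ⟨m, n, rfl, rfl⟩ := exists_mn h h'
    rw [FF_mn]
    rcases he with rfl | rfl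
    · rcases n with _ | n
      · rw [FF_zero (by rw [abs_of_nonneg] <;> push_cast <;> omega)]; push_cast; ring
      · have e1 : (m:ℤ) - ((n+1:ℕ):ℤ) + 1 = m - n := by push_cast; ring
        rw [e1, show m + (n+1) - 1 = m + n by omega, FF_mn]
        have b2 : (m+n).choose n = (m+n).choose m := by
          rw [← Nat.choose_symm_of_eq_add]; ring
        have b1 : (m+n+1).choose m = (m+n+1).choose (n+1) := by
          rw [← Nat.choose_symm_of_eq_add]; ring
        have a2 := Nat.add_one_mul_choose_eq (m+n) n
        rw [b2, ← b1] at a2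
        have a2' : ((m:ℝ)+n+1) * ((m+n).choose m) = ((m+n+1).choose m) * (n+1) := by
          exact_mod_cast a2
        rw [show m + (n+1) = m+n+1 by ring, pow_succ, mul_inv]
        push_cast
        linear_combination ((2:ℝ)^(m+n))⁻¹ * a2'
    · rcases m with _ | m
      · rw [FF_zero (by rw [abs_of_nonpos] <;> push_cast <;> omega)]; push_cast; ring
      · have e1 : ((m+1:ℕ):ℤ) - n + -1 = m - n := by push_cast; ring
        rw [e1, show m + 1 + n - 1 = m + n by omega, FF_mn]
        have a2 := Nat.add_one_mul_choose_eq (m+n) m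
        have a2' : ((m:ℝ)+n+1) * ((m+n).choose m) = ((m+n+1).choose (m+1)) * (m+1) := by
          exact_mod_cast a2
        rw [show m + 1 + n = m+n+1 by ring, pow_succ, mul_inv]
        push_cast
        linear_combination ((2:ℝ)^(m+n))⁻¹ * a2'
  · rw [FF_zero h', FF_zero]
    · ring
    · rcases he with rfl | rfl <;> rw [lt_abs] at h' ⊢ <;> omega

theorem MonoOrAntiOn_neg {g : ℕ → ℝ} {S : Set ℕ} (h : MonoOrAntiOn g S) :
    MonoOrAntiOn (fun t => - g t) S := by
  rcases h with h | h
  · exact Or.inr h.neg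
  · exact Or.inl h.neg

theorem UnimodalOn_neg {g : ℕ → ℝ} {S : Set ℕ} (h : UnimodalOn g S) :
    UnimodalOn (fun t => - g t) S := by
  obtain ⟨t, ht, h1, h2⟩ := h
  exact ⟨t, ht, MonoOrAntiOn_neg h1, MonoOrAntiOn_neg h2⟩

theorem MonoOrAntiOn_congr {g g' : ℕ → ℝ} {S : Set ℕ} (e : Set.EqOn g g' S)
    (h : MonoOrAntiOn g S) : MonoOrAntiOn g' S := by
  rcases h with h | h
  · exact Or.inl (h.congr e)
  · exact Or.inr (h.congr e)

theorem UnimodalOn_congr {g g' : ℕ → ℝ} {S : Set ℕ} (e : Set.EqOn g g' S)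
    (h : UnimodalOn g S) : UnimodalOn g' S := by
  obtain ⟨t, ht, h1, h2⟩ := h
  exact ⟨t, ht, MonoOrAntiOn_congr (e.mono Set.inter_subset_left) h1,
    MonoOrAntiOn_congr (e.mono Set.inter_subset_left) h2⟩

theorem mono_steps (x : Vtx) (g : ℕ → ℝ) (s t : ℕ) (hs : s ∈ Xdom x) (ht : t ∈ Xdom x)
    (hst : s ≤ t) (h : ∀ u ∈ Xdom x, s ≤ u → u + 2 ≤ t → g u ≤ g (u+2)) : g s ≤ g t := by
  have key : ∀ k : ℕ, s + 2*k ≤ t → g s ≤ g (s+2*k) := by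
    intro k
    induction k with
    | zero => intro _; simp
    | succ k ih =>
      intro hk
      refine (ih (by omega)).trans ?_
      have hm : s + 2*k ∈ Xdom x := by
        refine ⟨?_, ?_⟩
        · have := hs.1; omega
        · have := hs.2; push_cast; omega
      exact h _ hm (by omega) (by omega)
  have e : s + 2*((t-s)/2) = t := by
    have h1 := hs.2
    have h2 := ht.2
    omega
  have := key ((t-s)/2) (by omega)
  rwa [e] at this

theorem unimodal_of_steps (x : Vtx) (g : ℕ → ℝ)
    (h : ∀ t ∈ Xdom x, ∀ t' ∈ Xdom x, t ≤ t' → g (t+2) < g t → g (t'+2) ≤ g t') :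
    UnimodalOn g (Xdom x) := by
  classical
  by_cases hex : ∃ t, t ∈ Xdom x ∧ g (t+2) < g t
  · refine ⟨Nat.find hex, (Nat.find_spec hex).1, Or.inl ?_, Or.inr ?_⟩
    · rintro s ⟨hs, _⟩ t ⟨ht, ht'⟩ hst
      refine mono_steps x g s t hs ht hst (fun u hu _ hut => ?_)
      have : u < Nat.find hex := by
        have : t ≤ Nat.find hex := ht'
        omega
      by_contra hc
      exact Nat.find_min hex this ⟨hu, not_le.mp hc⟩
    · rintro s ⟨hs, hs'⟩ t ⟨ht, _⟩ hst
      have := mono_steps x (fun u => - g u) s t hs ht hst (fun u hu hsu _ => by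
        have := h _ (Nat.find_spec hex).1 u hu (le_trans hs' hsu) (Nat.find_spec hex).2
        simpa using this)
      simpa using this
  · have hm : ∀ S : Set ℕ, MonotoneOn g (Xdom x ∩ S) := by
      rintro S s ⟨hs, _⟩ t ⟨ht, _⟩ hst
      refine mono_steps x g s t hs ht hst (fun u hu _ _ => ?_)
      by_contra hc
      exact hex ⟨u, hu, not_le.mp hc⟩
    obtain ⟨t, ht⟩ : ∃ t, t ∈ Xdom x := by
      rcases Int.emod_two_eq_zero_or_one x.1 with e | e
      · exact ⟨2, by norm_num, by rw [e]; norm_num⟩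
      · exact ⟨1, by norm_num, by rw [e]; norm_num⟩
    exact ⟨t, ht, Or.inl (hm _), Or.inl (hm _)⟩

/-- Unimodality from the polynomial sign condition. -/
theorem unimodal_core (x : Vtx) (hx : inV x) (c d M : ℤ) (hM1 : |x.1| ≤ M) (hM2 : |x.2| ≤ M)
    (hM : M = |x.1| ∨ M = |x.2|)
    (hpos : ∀ t : ℤ, M ≤ t → 0 ≤ c*t+d)
    (hD : ∀ t t' : ℤ, M ≤ t → t ≤ t' → DD (x.1^2) (x.2^2) c d t < 0 →
      DD (x.1^2) (x.2^2) c d t' ≤ 0) :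
    UnimodalOn (fun t => H x t * ((c:ℝ)*t+d) / (t:ℝ)^2) (Xdom x) := by
  set g : ℕ → ℝ := fun t => H x t * ((c:ℝ)*t+d) / (t:ℝ)^2 with hg
  have Hnn : ∀ t, 0 ≤ H x t := fun t => by
    rw [H_eq_FF]; exact mul_nonneg (FF_nonneg _ _) (FF_nonneg _ _)
  have Hz : ∀ t : ℕ, (t:ℤ) < M → H x t = 0 := fun t ht => by
    rw [H_eq_FF]
    rcases hM with e | e
    · rw [FF_zero (by rw [← e]; exact ht), zero_mul]
    · rw [FF_zero (a := x.2) (by rw [← e]; exact ht), mul_zero]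
  have gnn : ∀ t, 0 ≤ g t := fun t => by
    rcases lt_or_ge (t:ℤ) M with h | h
    · simp [hg, Hz t h]
    · have h1 : (0:ℝ) ≤ (c:ℝ)*t+d := by exact_mod_cast hpos t h
      exact div_nonneg (mul_nonneg (Hnn t) h1) (by positivity)
  -- the increment
  have inc : ∀ t ∈ Xdom x, M ≤ (t:ℤ) → ∃ K : ℝ, 0 ≤ K ∧
      g (t+2) - g t = K * (DD (x.1^2) (x.2^2) c d t : ℤ) := by
    intro t ht hMt
    have s1 := FF_step (a := x.1) (t := t) ht.2.symm
    have s2 := FF_step (a := x.2) (t := t) (hx ▸ ht.2.symm)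
    have tp : (1:ℝ) ≤ t := by exact_mod_cast ht.1
    have b1 : ∀ a : ℤ, |a| ≤ M → (0:ℝ) < ((t:ℝ)+2)^2 - (a:ℝ)^2 := by
      intro a ha
      have h1 : |(a:ℝ)| ≤ t := by exact_mod_cast ha.trans hMt
      have h2 := abs_le.mp h1
      nlinarith
    have B1 := b1 _ hM1
    have B2 := b1 _ hM2
    set E1 := ((t:ℝ)+2)^2 - (x.1:ℝ)^2 with hE1
    set E2 := ((t:ℝ)+2)^2 - (x.2:ℝ)^2 with hE2
    have hstep : H x (t+2) = H x t * (((t:ℝ)+1)*((t:ℝ)+2))^2 / (E1 * E2) := by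
      rw [eq_div_iff (by positivity), H_eq_FF, H_eq_FF]
      linear_combination (FF x.2 (t+2) * E2) * s1 + FF x.1 t * (((t:ℝ)+1)*((t:ℝ)+2)) * s2
    refine ⟨H x t / ((t:ℝ)^2 * (E1*E2)), div_nonneg (Hnn t) (by positivity), ?_⟩
    have hDD : ((DD (x.1^2) (x.2^2) c d t : ℤ) : ℝ)
        = (t:ℝ)^2*((t:ℝ)+1)^2*(c*((t:ℝ)+2)+d) - (c*(t:ℝ)+d)*E1*E2 := by
      unfold DD; rw [hE1, hE2]; push_cast; ring
    rw [hDD]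
    simp only [hg]
    rw [hstep]
    push_cast
    field_simp
  refine unimodal_of_steps x g (fun t ht t' ht' htt hlt => ?_)
  have hMt : M ≤ (t:ℤ) := by
    by_contra hc
    have : g t = 0 := by simp [hg, Hz t (not_le.mp hc)]
    have := gnn (t+2)
    linarith
  have htt' : (t:ℤ) ≤ t' := by exact_mod_cast htt
  obtain ⟨K, hK, e⟩ := inc t ht hMt
  obtain ⟨K', hK', e'⟩ := inc t' ht' (hMt.trans htt')
  have hneg : DD (x.1^2) (x.2^2) c d t < 0 := by
    by_contra hc
    have : (0:ℝ) ≤ (DD (x.1^2) (x.2^2) c d t : ℤ) := by exact_mod_cast not_lt.mp hc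
    have := mul_nonneg hK this
    linarith
  have h2 : ((DD (x.1^2) (x.2^2) c d t' : ℤ):ℝ) ≤ 0 := by exact_mod_cast hD t t' hMt htt' hneg
  have := mul_nonpos_of_nonneg_of_nonpos hK' h2
  linarith

theorem INF_formula (x : Vtx) (hx : inV x) (A : Vtx) (h1 : A.1 = 1 ∨ A.1 = -1)
    (h2 : A.2 = 1 ∨ A.2 = -1) (t : ℕ) (ht : t ∈ Xdom x) :
    INF x A t = H x t * (((-(A.1*x.1 + A.2*x.2) : ℤ):ℝ) * t + ((A.1*x.1*(A.2*x.2) : ℤ):ℝ)) / (t:ℝ)^2 := by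
  have s1 := FF_shift (a := x.1) ht.1 ht.2.symm h1
  have s2 := FF_shift (a := x.2) ht.1 (hx ▸ ht.2.symm) h2
  have tp : (1:ℝ) ≤ t := by exact_mod_cast ht.1
  have : (0:ℝ) < t := by linarith
  rw [eq_div_iff (by positivity)]
  unfold INF
  rw [H_eq_FF, H_eq_FF]
  simp only [Prod.fst_add, Prod.snd_add]
  push_cast
  linear_combination (FF (x.2 + A.2) (t-1) * t) * s1 + FF x.1 t * ((t:ℝ) - A.1*x.1) * s2

theorem DD_symm (A B c d t : ℤ) : DD A B c d t = DD B A c d t := by unfold DD; ring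

/-- Good triples. -/
theorem unimodal_good (x : Vtx) (hx : inV x) (a b c d : ℤ) (hb : 0 ≤ b) (hab : b ≤ a)
    (hxab : (|x.1| = a ∧ |x.2| = b) ∨ (|x.1| = b ∧ |x.2| = a))
    (hcd : (c = a + b ∧ d = -(a*b)) ∨ (c = a + b ∧ d = a*b) ∨ (c = a - b ∧ d = a*b)) :
    UnimodalOn (fun t => H x t * ((c:ℝ)*t+d) / (t:ℝ)^2) (Xdom x) := by
  have hD : ∀ t t' : ℤ, a ≤ t → t ≤ t' → DD (a^2) (b^2) c d t < 0 → DD (a^2) (b^2) c d t' ≤ 0 := by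
    intro t t' h1 h2 h3
    rcases hcd with ⟨rfl, rfl⟩ | ⟨rfl, rfl⟩ | ⟨rfl, rfl⟩
    · exact dsign_one a b t t' hb hab h1 h2 h3
    · exact dsign_two a b t t' hb hab h1 h2 h3
    · exact dsign_three a b t t' hb hab h1 h2 h3
  have hpos : ∀ t : ℤ, a ≤ t → 0 ≤ c*t+d := by
    intro t h1
    have ha : 0 ≤ a := hb.trans hab
    have ht : 0 ≤ t := ha.trans h1
    rcases hcd with ⟨rfl, rfl⟩ | ⟨rfl, rfl⟩ | ⟨rfl, rfl⟩
    · nlinarith [mul_nonneg ha ht, mul_nonneg hb (sub_nonneg.mpr h1)]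
    · positivity
    · have := mul_nonneg (sub_nonneg.mpr hab) ht
      have := mul_nonneg ha hb
      linarith
  rcases hxab with ⟨e1, e2⟩ | ⟨e1, e2⟩
  · refine unimodal_core x hx c d a e1.le (e2.trans_le hab) (Or.inl e1.symm) hpos ?_
    rw [← sq_abs x.1, ← sq_abs x.2, e1, e2]
    exact hD
  · refine unimodal_core x hx c d a (e1.trans_le hab) e2.le (Or.inr e2.symm) hpos ?_
    rw [← sq_abs x.1, ← sq_abs x.2, e1, e2]
    intro t t' h1 h2 h3
    rw [DD_symm] at h3 ⊢
    exact hD t t' h1 h2 h3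

theorem unimodal_INF (x : Vtx) (hx : inV x) (A : Vtx) (h1 : A.1 = 1 ∨ A.1 = -1)
    (h2 : A.2 = 1 ∨ A.2 = -1) (hor : 0 ≤ A.1*x.1*(A.2*x.2) ∨ 0 ≤ A.1*x.1 + A.2*x.2) :
    UnimodalOn (fun t => INF x A t) (Xdom x) := by
  have n1 : |x.1| = |A.1*x.1| := by rcases h1 with e | e <;> simp [e]
  have n2 : |x.2| = |A.2*x.2| := by rcases h2 with e | e <;> simp [e]
  have hF := INF_formula x hx A h1 h2
  generalize A.1*x.1 = p at *
  generalize A.2*x.2 = q at *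
  have pos : ∀ a b : ℤ, 0 ≤ b → b ≤ a → ((|p| = a ∧ |q| = b) ∨ (|p| = b ∧ |q| = a)) →
      ((-(p+q) = a + b ∧ p*q = -(a*b)) ∨ (-(p+q) = a + b ∧ p*q = a*b) ∨
        (-(p+q) = a - b ∧ p*q = a*b)) → UnimodalOn (fun t => INF x A t) (Xdom x) := by
    intro a b hb hab hh hc
    exact UnimodalOn_congr (fun t ht => (hF t ht).symm)
      (unimodal_good x hx a b _ _ hb hab (by rw [n1, n2]; exact hh) hc)
  have neg : ∀ a b : ℤ, 0 ≤ b → b ≤ a → ((|p| = a ∧ |q| = b) ∨ (|p| = b ∧ |q| = a)) →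
      ((p+q = a + b ∧ -(p*q) = -(a*b)) ∨ (p+q = a + b ∧ -(p*q) = a*b) ∨
        (p+q = a - b ∧ -(p*q) = a*b)) → UnimodalOn (fun t => INF x A t) (Xdom x) := by
    intro a b hb hab hh hc
    refine UnimodalOn_congr (fun t ht => ?_)
      (UnimodalOn_neg (unimodal_good x hx a b _ _ hb hab (by rw [n1, n2]; exact hh) hc))
    show _ = INF x A t
    rw [hF t ht]
    push_cast
    ring
  rcases le_total 0 p with hp | hp <;> rcases le_total 0 q with hq | hq
  · rw [abs_of_nonneg hp, abs_of_nonneg hq] at neg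
    rcases le_total p q with h | h
    · exact neg q p hp h (Or.inr ⟨rfl, rfl⟩) (Or.inl ⟨by ring, by ring⟩)
    · exact neg p q hq h (Or.inl ⟨rfl, rfl⟩) (Or.inl ⟨by ring, by ring⟩)
  · rw [abs_of_nonneg hp, abs_of_nonpos hq] at neg pos
    rcases le_total 0 (p+q) with h | h
    · exact neg p (-q) (by linarith) (by linarith) (Or.inl ⟨rfl, rfl⟩)
        (Or.inr (Or.inr ⟨by ring, by ring⟩))
    · have hz : p * q = 0 ∨ p + q = 0 := by
        rcases hor with h' | h'
        · exact Or.inl (le_antisymm (mul_nonpos_of_nonneg_of_nonpos hp hq) h')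
        · exact Or.inr (le_antisymm h h')
      rcases hz with hz | hz
      · rcases mul_eq_zero.mp hz with rfl | rfl
        · exact pos (-q) 0 le_rfl (by linarith) (Or.inr ⟨rfl, rfl⟩)
            (Or.inl ⟨by ring, by ring⟩)
        · exact neg p 0 le_rfl hp (Or.inl ⟨rfl, by simp⟩) (Or.inl ⟨by ring, by ring⟩)
      · exact neg p (-q) (by linarith) (by linarith) (Or.inl ⟨rfl, rfl⟩)
          (Or.inr (Or.inr ⟨by ring, by ring⟩))
  · rw [abs_of_nonpos hp, abs_of_nonneg hq] at neg pos
    rcases le_total 0 (p+q) with h | h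
    · exact neg q (-p) (by linarith) (by linarith) (Or.inr ⟨rfl, rfl⟩)
        (Or.inr (Or.inr ⟨by ring, by ring⟩))
    · have hz : p * q = 0 ∨ p + q = 0 := by
        rcases hor with h' | h'
        · exact Or.inl (le_antisymm (mul_nonpos_of_nonpos_of_nonneg hp hq) h')
        · exact Or.inr (le_antisymm h h')
      rcases hz with hz | hz
      · rcases mul_eq_zero.mp hz with rfl | rfl
        · exact neg q 0 le_rfl hq (Or.inr ⟨by simp, rfl⟩) (Or.inl ⟨by ring, by ring⟩)
        · exact pos (-p) 0 le_rfl (by linarith) (Or.inl ⟨rfl, rfl⟩)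
            (Or.inl ⟨by ring, by ring⟩)
      · exact neg q (-p) (by linarith) (by linarith) (Or.inr ⟨rfl, rfl⟩)
          (Or.inr (Or.inr ⟨by ring, by ring⟩))
  · rw [abs_of_nonpos hp, abs_of_nonpos hq] at pos
    rcases le_total p q with h | h
    · exact pos (-p) (-q) (by linarith) (by linarith) (Or.inl ⟨rfl, rfl⟩)
        (Or.inr (Or.inl ⟨by ring, by ring⟩))
    · exact pos (-q) (-p) (by linarith) (by linarith) (Or.inr ⟨rfl, rfl⟩)
        (Or.inr (Or.inl ⟨by ring, by ring⟩))

theorem DIR_cases {A : Vtx} (hA : A ∈ DIRset) : (A.1 = 1 ∨ A.1 = -1) ∧ (A.2 = 1 ∨ A.2 = -1) := by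
  simp only [DIRset, Finset.mem_insert, Finset.mem_singleton] at hA
  rcases hA with rfl | rfl | rfl | rfl <;> simp

/-- For each vertex `x ∈ V` there is at most one direction `A ∈ DIR` whose
influence `t ↦ INF(x,A,t)` is strictly bimodal on the positive integers
`t ≡ x₁ (mod 2)`. -/
theorem INF_strictlyBimodal_unique (x : Vtx) (hx : inV x) (A A' : Vtx)
    (hA : A ∈ DIRset) (hA' : A' ∈ DIRset)
    (h1 : StrictlyBimodalOn (fun t => INF x A t) (Xdom x))
    (h2 : StrictlyBimodalOn (fun t => INF x A' t) (Xdom x)) :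
    A = A' := by
  obtain ⟨a1, a2⟩ := DIR_cases hA
  obtain ⟨b1, b2⟩ := DIR_cases hA'
  have k1 : ¬ (0 ≤ A.1*x.1*(A.2*x.2) ∨ 0 ≤ A.1*x.1 + A.2*x.2) :=
    fun h => h1.2 (unimodal_INF x hx A a1 a2 h)
  have k2 : ¬ (0 ≤ A'.1*x.1*(A'.2*x.2) ∨ 0 ≤ A'.1*x.1 + A'.2*x.2) :=
    fun h => h2.2 (unimodal_INF x hx A' b1 b2 h)
  push Not at k1 k2
  obtain ⟨k1, k1'⟩ := k1
  obtain ⟨k2, k2'⟩ := k2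
  rcases a1 with a1 | a1 <;> rcases a2 with a2 | a2 <;> rcases b1 with b1 | b1 <;>
    rcases b2 with b2 | b2 <;> rw [a1, a2] at k1 k1' <;> rw [b1, b2] at k2 k2' <;>
    first
      | exact Prod.ext (a1.trans b1.symm) (a2.trans b2.symm)
      | (exfalso; linarith)
end

section
/- For every x ∈ V with x ≠ (0,0), the function t ↦ H(x,t)/t, regarded on the positive integers t with t ≡ x₁ (mod 2), is unimodal and attains its global maximum at a point t_max(x) satisfying (x₁²+x₂²)/4 − 2 ≤ t_max(x) ≤ (x₁²+x₂²)/4 + 1. -/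
open Finset

lemma aux_choose (t : ℕ) (a : ℤ) (ha : |a| ≤ (t : ℤ)) (hp : a % 2 = (t : ℤ) % 2) :
    0 < (Nat.choose t (((t : ℤ) + a) / 2).toNat : ℝ) ∧
    (Nat.choose (t + 2) ((((t + 2 : ℕ) : ℤ) + a) / 2).toNat : ℝ) * (((t : ℝ) + 2) ^ 2 - (a : ℝ) ^ 2)
      = 4 * ((t : ℝ) + 1) * ((t : ℝ) + 2) * (Nat.choose t (((t : ℤ) + a) / 2).toNat : ℝ) := by
  rw [abs_le] at ha
  obtain ⟨k, hk⟩ : ∃ k : ℕ, (t : ℤ) + a = 2 * k := ⟨(((t : ℤ) + a) / 2).toNat, by omega⟩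
  obtain ⟨j, hj⟩ : ∃ j : ℕ, (t : ℤ) - a = 2 * j := ⟨(((t : ℤ) - a) / 2).toNat, by omega⟩
  have ht : t = k + j := by omega
  have haa : a = k - j := by omega
  have e1 : (((t : ℤ) + a) / 2).toNat = k := by omega
  have e2 : ((((t + 2 : ℕ) : ℤ) + a) / 2).toNat = k + 1 := by push_cast; omega
  rw [e1, e2]
  subst ht
  subst haa
  refine ⟨by exact_mod_cast Nat.choose_pos (by omega), ?_⟩
  have h1 := Nat.add_one_mul_choose_eq (k + j + 1) k
  have h2 := Nat.choose_mul_succ_eq (k + j) k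
  rw [show k + j + 1 - k = j + 1 by omega] at h2
  have h1' : ((k : ℝ) + j + 1 + 1) * ((k + j + 1).choose k : ℝ)
    = ((k + j + 2).choose (k + 1) : ℝ) * (k + 1) := by exact_mod_cast h1
  have h2' : ((k + j).choose k : ℝ) * (k + j + 1) = ((k + j + 1).choose k : ℝ) * (j + 1) := by
    exact_mod_cast h2
  push_cast
  linear_combination (-4 * (j + 1 : ℝ)) * h1' - 4 * ((k : ℝ) + j + 2) * h2'

lemma aux_H_nonneg (x : Vtx) (t : ℕ) : 0 ≤ H x t := by
  unfold H; split_ifs <;> positivity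

lemma aux_H_zero (x : Vtx) (t : ℕ) (h : (t : ℤ) < max |x.1| |x.2|) : H x t = 0 := by
  unfold H
  rw [if_neg]
  rintro ⟨_, _, h1, h2⟩
  exact absurd (max_le h1 h2) (not_le.mpr h)

lemma aux_H_step (x : Vtx) (hx : inV x) (t : ℕ) (ht : t ∈ Xdom x)
    (h : max |x.1| |x.2| ≤ (t : ℤ)) :
    0 < H x t ∧ H x (t + 2) * ((((t : ℝ) + 2) ^ 2 - (x.1 : ℝ) ^ 2) * (((t : ℝ) + 2) ^ 2 - (x.2 : ℝ) ^ 2))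
      = H x t * (((t : ℝ) + 1) * ((t : ℝ) + 2)) ^ 2 := by
  obtain ⟨ht1, ht2⟩ := ht
  unfold inV at hx
  have ha := (le_max_left _ _).trans h
  have hb := (le_max_right _ _).trans h
  obtain ⟨p1, s1⟩ := aux_choose t x.1 ha (by omega)
  obtain ⟨p2, s2⟩ := aux_choose t x.2 hb (by omega)
  have E1 : H x t = (4 : ℝ) ^ (-(t : ℤ)) * (Nat.choose t (((t : ℤ) + x.1) / 2).toNat)
      * (Nat.choose t (((t : ℤ) + x.2) / 2).toNat) := by
    unfold H; rw [if_pos ⟨by omega, by omega, ha, hb⟩]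
  have E2 : H x (t + 2) = (4 : ℝ) ^ (-((t + 2 : ℕ) : ℤ)) *
      (Nat.choose (t + 2) ((((t + 2 : ℕ) : ℤ) + x.1) / 2).toNat)
      * (Nat.choose (t + 2) ((((t + 2 : ℕ) : ℤ) + x.2) / 2).toNat) := by
    unfold H; rw [if_pos ⟨by push_cast; omega, by push_cast; omega, by push_cast; omega, by push_cast; omega⟩]
  have E3 : (4 : ℝ) ^ (-((t + 2 : ℕ) : ℤ)) = (4 : ℝ) ^ (-(t : ℤ)) / 16 := by
    push_cast
    rw [neg_add, zpow_add₀ (by norm_num)]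
    norm_num
    ring
  refine ⟨by rw [E1]; positivity, ?_⟩
  rw [E1, E2, E3]
  generalize (4 : ℝ) ^ (-(t : ℤ)) = q at *
  generalize (Nat.choose (t + 2) ((((t + 2 : ℕ) : ℤ) + x.1) / 2).toNat : ℝ) = A at *
  generalize (Nat.choose (t + 2) ((((t + 2 : ℕ) : ℤ) + x.2) / 2).toNat : ℝ) = B at *
  generalize (Nat.choose t (((t : ℤ) + x.1) / 2).toNat : ℝ) = C at *
  generalize (Nat.choose t (((t : ℤ) + x.2) / 2).toNat : ℝ) = D at *
  linear_combination (q / 16) * (B * (((t : ℝ) + 2) ^ 2 - (x.2 : ℝ) ^ 2)) * s1 +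
    (q / 16) * (4 * ((t : ℝ) + 1) * ((t : ℝ) + 2) * C) * s2

/-- the cubic controlling the sign of increments -/
noncomputable def auxP (x : Vtx) (s : ℝ) : ℝ :=
  -4 * s ^ 3 + (5 + ((x.1 : ℝ) ^ 2 + (x.2 : ℝ) ^ 2)) * s ^ 2 - 2 * s - (x.1 : ℝ) ^ 2 * (x.2 : ℝ) ^ 2

lemma auxP_conc (x : Vtx) (u v w : ℝ) (hu : 0 < u) (huv : u ≤ v) (hvw : v ≤ w)
    (h1 : 0 ≤ auxP x u) (h2 : 0 ≤ auxP x w) : 0 ≤ auxP x v := by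
  rcases eq_or_lt_of_le huv with rfl | huv
  · exact h1
  have hw : 0 < w := by linarith
  have hv : 0 < v := by linarith
  have key : (w - u) * u * w * auxP x v = (w - v) * v * w * auxP x u + (v - u) * u * v * auxP x w
      + (w - v) * (v - u) * (w - u) * (4 * u * v * w + (x.1 : ℝ) ^ 2 * (x.2 : ℝ) ^ 2) := by
    unfold auxP; ring
  have a1 : 0 ≤ w - v := by linarith
  have a2 : 0 < v - u := by linarith
  have a3 : 0 < w - u := by linarith
  have : 0 ≤ (w - u) * u * w * auxP x v := by rw [key]; positivity
  exact nonneg_of_mul_nonneg_right this (by positivity)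

lemma aux_iff (x : Vtx) (hx : inV x) (t : ℕ) (ht : t ∈ Xdom x)
    (h : max |x.1| |x.2| ≤ (t : ℤ)) :
    H x t / t ≤ H x (t + 2) / ((t + 2 : ℕ) : ℝ) ↔ 0 ≤ auxP x ((t : ℝ) + 2) := by
  obtain ⟨p, s⟩ := aux_H_step x hx t ht h
  have t0 : (0 : ℝ) < t := by exact_mod_cast ht.1
  have ha : |(x.1 : ℝ)| ≤ t := by exact_mod_cast (le_max_left _ _).trans h
  have hb : |(x.2 : ℝ)| ≤ t := by exact_mod_cast (le_max_right _ _).trans h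
  have ha2 : 0 < ((t : ℝ) + 2) ^ 2 - (x.1 : ℝ) ^ 2 := by
    rw [abs_le] at ha; nlinarith
  have hb2 : 0 < ((t : ℝ) + 2) ^ 2 - (x.2 : ℝ) ^ 2 := by
    rw [abs_le] at hb; nlinarith
  set D := (((t : ℝ) + 2) ^ 2 - (x.1 : ℝ) ^ 2) * (((t : ℝ) + 2) ^ 2 - (x.2 : ℝ) ^ 2) with hD
  have hDp : 0 < D := by positivity
  rw [div_le_div_iff₀ t0 (by positivity), ← sub_nonneg]
  push_cast
  have key : D * (H x (t + 2) * t - H x t * (t + 2)) = (H x t * (t + 2)) * auxP x ((t : ℝ) + 2) := by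
    have : D * (H x (t + 2) * t - H x t * (t + 2))
      = t * (H x (t + 2) * D) - D * H x t * (t + 2) := by ring
    rw [this, s, hD]; unfold auxP; ring
  have q : 0 < H x t * ((t : ℝ) + 2) := by positivity
  constructor
  · intro hh
    have : 0 ≤ D * (H x (t + 2) * t - H x t * (t + 2)) := by positivity
    rw [key] at this
    exact nonneg_of_mul_nonneg_right this q
  · intro hh
    have : 0 ≤ (H x t * (t + 2)) * auxP x ((t : ℝ) + 2) := by positivity
    rw [← key] at this
    exact nonneg_of_mul_nonneg_right this hDp

lemma auxP_m (x : Vtx) (hx0 : x ≠ (0, 0)) (m : ℤ) (hm : m = max |x.1| |x.2|) :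
    0 < m ∧ 0 ≤ auxP x m := by
  have h0 : 0 < m := by
    by_contra hc
    apply hx0
    have h1 : |x.1| ≤ 0 := (le_max_left |x.1| |x.2|).trans (by omega)
    have h2 : |x.2| ≤ 0 := (le_max_right |x.1| |x.2|).trans (by omega)
    exact Prod.ext (abs_nonpos_iff.mp h1) (abs_nonpos_iff.mp h2)
  refine ⟨h0, ?_⟩
  have hz : ((m : ℝ) ^ 2 - (x.1 : ℝ) ^ 2) * ((m : ℝ) ^ 2 - (x.2 : ℝ) ^ 2) = 0 := by
    rcases max_choice |x.1| |x.2| with h | h <;> rw [h] at hm <;> subst hm <;> simp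
  have e : auxP x m = m * (m - 1) ^ 2 * (m - 2) -
    ((m : ℝ) ^ 2 - (x.1 : ℝ) ^ 2) * ((m : ℝ) ^ 2 - (x.2 : ℝ) ^ 2) := by unfold auxP; ring
  rw [e, hz, sub_zero]
  rcases (show m = 1 ∨ 2 ≤ m by omega) with h | h
  · subst h; simp
  · have : (2 : ℝ) ≤ m := by exact_mod_cast h
    have : (0 : ℝ) ≤ m - 2 := by linarith
    positivity

lemma auxP_neg (x : Vtx) (s : ℝ) (hs : 0 < s)
    (h : 5 + ((x.1 : ℝ) ^ 2 + (x.2 : ℝ) ^ 2) ≤ 4 * s) : auxP x s < 0 := by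
  have e : auxP x s = -(s ^ 2 * (4 * s - (5 + ((x.1 : ℝ) ^ 2 + (x.2 : ℝ) ^ 2)))) - 2 * s
    - (x.1 : ℝ) ^ 2 * (x.2 : ℝ) ^ 2 := by unfold auxP; ring
  have : 0 ≤ 4 * s - (5 + ((x.1 : ℝ) ^ 2 + (x.2 : ℝ) ^ 2)) := by linarith
  have : 0 ≤ s ^ 2 * (4 * s - (5 + ((x.1 : ℝ) ^ 2 + (x.2 : ℝ) ^ 2))) := by positivity
  have : 0 ≤ (x.1 : ℝ) ^ 2 * (x.2 : ℝ) ^ 2 := by positivity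
  linarith

lemma aux_steps (g : ℕ → ℝ) (a n : ℕ) (h : ∀ i < n, g (a + 2 * i) ≤ g (a + 2 * (i + 1))) :
    g a ≤ g (a + 2 * n) := by
  induction n with
  | zero => simp
  | succ n ih => exact (ih fun i hi => h i (by omega)).trans (h n (by omega))

theorem H_div_t_unimodal (x : Vtx) (hx : inV x) (hx0 : x ≠ (0, 0)) :
    UnimodalOn (fun t => H x t / t) (Xdom x) ∧
    ∃ tm ∈ Xdom x, (∀ t ∈ Xdom x, H x t / t ≤ H x tm / tm) ∧
      ((x.1 : ℝ)^2 + (x.2 : ℝ)^2) / 4 - 2 ≤ (tm : ℝ) ∧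
      (tm : ℝ) ≤ ((x.1 : ℝ)^2 + (x.2 : ℝ)^2) / 4 + 1 := by
  classical
  set g : ℕ → ℝ := fun t => H x t / t with hg
  obtain ⟨m, hm⟩ : ∃ m : ℤ, m = max |x.1| |x.2| := ⟨_, rfl⟩
  obtain ⟨m0, hPm⟩ := auxP_m x hx0 m hm
  have m0R : (0 : ℝ) < m := by exact_mod_cast m0
  have hiff : ∀ t ∈ Xdom x, m ≤ t → (g t ≤ g (t + 2) ↔ 0 ≤ auxP x ((t : ℝ) + 2)) :=
    fun t ht h => aux_iff x hx t ht (hm ▸ h)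
  have hlow : ∀ t : ℕ, (t : ℤ) < m → g t ≤ g (t + 2) := by
    intro t h
    simp only [hg, aux_H_zero x t (hm ▸ h), zero_div]
    exact div_nonneg (aux_H_nonneg _ _) (by positivity)
  have hsucc : ∀ t ∈ Xdom x, ∀ i : ℕ, t + 2 * i ∈ Xdom x := by
    rintro t ⟨h1, h2⟩ i
    exact ⟨by omega, by push_cast; omega⟩
  have hpar : ∀ t ∈ Xdom x, ∀ t' ∈ Xdom x, t ≤ t' → ∃ n, t' = t + 2 * n := by
    rintro t ⟨h1, h2⟩ t' ⟨h3, h4⟩ h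
    exact ⟨(t' - t) / 2, by omega⟩
  have hm2 : m ^ 2 ≤ x.1 ^ 2 + x.2 ^ 2 := by
    rcases max_choice |x.1| |x.2| with h | h <;> rw [h] at hm <;> subst hm <;>
      rw [sq_abs] <;> nlinarith [sq_nonneg x.1, sq_nonneg x.2]
  have hm2R : (m : ℝ) ^ 2 ≤ (x.1 : ℝ) ^ 2 + (x.2 : ℝ) ^ 2 := by exact_mod_cast hm2
  have hmpar : m % 2 = x.1 % 2 := by
    unfold inV at hx
    have b1 := abs_choice x.1
    have b2 := abs_choice x.2
    have b3 := max_choice |x.1| |x.2|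
    rw [← hm] at b3
    clear hm hm2 hm2R
    omega
  have hex : ∃ t : ℕ, t ∈ Xdom x ∧ ¬ g t ≤ g (t + 2) := by
    obtain ⟨n, hn⟩ : ∃ n : ℕ, (n : ℤ) = m + 2 * (5 + x.1 ^ 2 + x.2 ^ 2) :=
      ⟨(m + 2 * (5 + x.1 ^ 2 + x.2 ^ 2)).toNat, by
        rw [Int.toNat_of_nonneg (by positivity)]⟩
    have p1 : 0 ≤ x.1 ^ 2 + x.2 ^ 2 := by positivity
    have hnX : n ∈ Xdom x := ⟨by omega, by omega⟩
    refine ⟨n, hnX, ?_⟩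
    rw [hiff n hnX (by omega), not_le]
    have hnR : (n : ℝ) = m + 2 * (5 + (x.1 : ℝ) ^ 2 + (x.2 : ℝ) ^ 2) := by exact_mod_cast hn
    apply auxP_neg _ _ (by positivity)
    nlinarith [sq_nonneg (x.1 : ℝ), sq_nonneg (x.2 : ℝ)]
  obtain ⟨tm, ⟨htm, hdown⟩, hmin⟩ : ∃ tm : ℕ, (tm ∈ Xdom x ∧ ¬ g tm ≤ g (tm + 2)) ∧
      ∀ t ∈ Xdom x, t < tm → g t ≤ g (t + 2) := by
    refine ⟨Nat.find hex, Nat.find_spec hex, fun t ht hlt => ?_⟩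
    have := Nat.find_min hex hlt
    by_contra hc
    exact this ⟨ht, hc⟩
  have hmtm : m ≤ tm := by
    by_contra hc
    exact hdown (hlow tm (by omega))
  have hmtmR : (m : ℝ) ≤ tm := by exact_mod_cast hmtm
  have hPtm : auxP x ((tm : ℝ) + 2) < 0 := by
    rw [hiff tm htm hmtm, not_le] at hdown; exact hdown
  have hdec : ∀ t ∈ Xdom x, tm ≤ t → g (t + 2) ≤ g t := by
    intro t ht hle
    by_contra hc
    have h1 := (hiff t ht (by omega)).mp (not_le.mp hc).le
    have hleR : (tm : ℝ) ≤ t := by exact_mod_cast hle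
    have := auxP_conc x m ((tm : ℝ) + 2) ((t : ℝ) + 2) m0R (by linarith) (by linarith) hPm h1
    linarith
  have hup : MonotoneOn g (Xdom x ∩ Set.Iic tm) := by
    rintro a ⟨ha, ha'⟩ b ⟨hb, hb'⟩ hab
    obtain ⟨n, rfl⟩ := hpar a ha b hb hab
    simp only [Set.mem_Iic] at ha' hb'
    exact aux_steps g a n fun i hi => hmin (a + 2 * i) (hsucc a ha i) (by omega)
  have hdn : AntitoneOn g (Xdom x ∩ Set.Ici tm) := by
    rintro a ⟨ha, ha'⟩ b ⟨hb, hb'⟩ hab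
    obtain ⟨n, rfl⟩ := hpar a ha b hb hab
    simp only [Set.mem_Ici] at ha' hb'
    have := aux_steps (fun t => - g t) a n fun i hi =>
      neg_le_neg (hdec (a + 2 * i) (hsucc a ha i) (by omega))
    simpa using this
  refine ⟨⟨tm, htm, Or.inl hup, Or.inr hdn⟩, tm, htm, ?_, ?_, ?_⟩
  · intro t ht
    rcases le_total t tm with h | h
    · exact hup ⟨ht, h⟩ ⟨htm, le_refl tm⟩ h
    · exact hdn ⟨htm, le_refl tm⟩ ⟨ht, h⟩ h
  · by_contra hc
    rw [not_le] at hc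
    set c : ℝ := ((x.1 : ℝ)^2 + (x.2 : ℝ)^2) / 4 with hcd
    have ht0 : (1 : ℝ) ≤ tm := by exact_mod_cast htm.1
    have hPc : 0 ≤ auxP x c := by
      have hS : (x.1 : ℝ)^2 + (x.2 : ℝ)^2 = 4 * c := by rw [hcd]; ring
      have hQ : (x.1 : ℝ)^2 * (x.2 : ℝ)^2 ≤ 4 * c ^ 2 := by
        nlinarith [sq_nonneg ((x.1 : ℝ)^2 - (x.2 : ℝ)^2)]
      unfold auxP
      rw [hS]
      nlinarith
    have := auxP_conc x m ((tm : ℝ) + 2) c m0R (by linarith) (by linarith) hPm hPc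
    linarith
  · by_contra hc
    rw [not_le] at hc
    rcases lt_or_ge ((tm : ℤ) - 2) m with h | h
    · have : m = tm := by
        have := htm.2
        omega
      have : (m : ℝ) = tm := by exact_mod_cast this
      nlinarith [sq_nonneg ((m : ℝ) - 2)]
    · obtain ⟨s, rfl⟩ : ∃ s, tm = s + 2 := ⟨tm - 2, by omega⟩
      have hsX : s ∈ Xdom x := ⟨by push_cast at h; omega, by have := htm.2; push_cast at this; omega⟩
      have h1 := (hiff s hsX (by push_cast at h; omega)).mp (hmin s hsX (by omega))
      have h2 : x.1 ^ 2 + x.2 ^ 2 + 4 < 4 * ((s : ℤ) + 2) := by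
        have : (x.1 : ℝ) ^ 2 + (x.2 : ℝ) ^ 2 + 4 < 4 * ((s : ℝ) + 2) := by
          push_cast at hc; linarith
        exact_mod_cast this
      have h3 : 5 + (x.1 ^ 2 + x.2 ^ 2) ≤ 4 * ((s : ℤ) + 2) := by omega
      have h4 : 5 + ((x.1 : ℝ) ^ 2 + (x.2 : ℝ) ^ 2) ≤ 4 * ((s : ℝ) + 2) := by exact_mod_cast h3
      have := auxP_neg x ((s : ℝ) + 2) (by positivity) h4
      linarith
end
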